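/- Fix a cluster j with finite client set G_j. For each k ∈ G_j let n_k ≥ 2 and 1 ≤ λ_k ≤ n_k be natural numbers, and let the satellite dataset size n_S ≥ 2 and batch size 1 ≤ λ_S ≤ n_S be natural numbers; let s = n_S + Σ_{k∈G_j} n_k. Let X and H be real inner product spaces and ρ ≥ 0. For each k ∈ G_j, let x^{(k)} : Fin n_k → X and g^{(k)} : Fin n_k → H satisfy ‖g^{(k)}_i − g^{(k)}_{i′}‖² ≤ ρ‖x^{(k)}_i − x^{(k)}_{i′}‖² for all i, i′, with sample variance V_k = (1/(n_k−1)) Σ_i ‖x^{(k)}_i − x̄^{(k)}‖² and full mean ḡ^{(k)}; similarly let x^{(S)} : Fin n_S → X and g^{(S)} : Fin n_S → H satisfy the same condition with sample variance V_S and full mean ḡ^{(S)}. Draw independently a uniform λ_k-element subset S_k of Fin n_k for each k and a uniform λ_S-element subset S_S of Fin n_S, and set the aggregated stochastic gradient error Δ = (1/s)(n_S[(1/λ_S)Σ_{i∈S_S} g^{(S)}_i − ḡ^{(S)}] + Σ_{k∈G_j} n_k[(1/λ_k)Σ_{i∈S_k} g^{(k)}_i − ḡ^{(k)}]). Then the expectation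 of ‖Δ‖² over the independent uniform draws satisfies E[‖Δ‖²] ≤ (2/s)[ Σ_{k∈G_j} (1 − λ_k/n_k)((n_k − 1)ρ/λ_k) V_k + (1 − λ_S/n_S)((n_S − 1)ρ/λ_S) V_S ]. -/

import Mathlib

theorem sum_sub_mean_eq_zero {ι E : Type*} [Fintype ι] [Nonempty ι] [AddCommGroup E] [Module ℝ E]
    (f : ι → E) : ∑ i, (f i - (Fintype.card ι : ℝ)⁻¹ • ∑ j, f j) = 0 := by
  rw [Finset.sum_sub_distrib, Finset.sum_const, Finset.card_univ, ← Nat.cast_smul_eq_nsmul ℝ,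
    smul_inv_smul₀ (by simp), sub_self]

open scoped BigOperators RealInnerProductSpace in
/-- The sum of the squared pairwise distances of a finite family is twice its size times the sum of
the squared distances to the mean. -/
theorem sum_sum_norm_sub_sq {ι E : Type*} [Fintype ι] [Nonempty ι] [NormedAddCommGroup E]
    [InnerProductSpace ℝ E] (f : ι → E) :
    ∑ i, ∑ j, ‖f i - f j‖ ^ 2 =
      2 * Fintype.card ι * ∑ i, ‖f i - (Fintype.card ι : ℝ)⁻¹ • ∑ j, f j‖ ^ 2 := by
  set m := (Fintype.card ι : ℝ)⁻¹ • ∑ j, f j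
  have h0 : ∑ i, (f i - m) = 0 := sum_sub_mean_eq_zero f
  have hexp (i j : ι) : ‖f i - f j‖ ^ 2 =
      ‖f i - m‖ ^ 2 - 2 * ⟪f i - m, f j - m⟫ + ‖f j - m‖ ^ 2 := by
    rw [← norm_sub_sq_real, sub_sub_sub_cancel_right]
  simp only [hexp, Finset.sum_add_distrib, Finset.sum_sub_distrib, ← Finset.mul_sum, ← inner_sum,
    h0, inner_zero_right, Finset.sum_const, Finset.card_univ, nsmul_eq_mul]
  ring

/-- If squared pairwise distances are dominated up to a factor, so are the sums of squared distances
to the mean. -/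
theorem sum_norm_sub_mean_sq_le {ι E F : Type*} [Fintype ι] [Nonempty ι] [NormedAddCommGroup E]
    [InnerProductSpace ℝ E] [NormedAddCommGroup F] [InnerProductSpace ℝ F] {f : ι → E} {x : ι → F}
    {ρ : ℝ} (h : ∀ i j, ‖f i - f j‖ ^ 2 ≤ ρ * ‖x i - x j‖ ^ 2) :
    ∑ i, ‖f i - (Fintype.card ι : ℝ)⁻¹ • ∑ j, f j‖ ^ 2 ≤
      ρ * ∑ i, ‖x i - (Fintype.card ι : ℝ)⁻¹ • ∑ j, x j‖ ^ 2 := by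
  have hc : (0 : ℝ) < 2 * Fintype.card ι := by
    have : 0 < Fintype.card ι := Fintype.card_pos
    positivity
  refine le_of_mul_le_mul_left ?_ hc
  calc _ = ∑ i, ∑ j, ‖f i - f j‖ ^ 2 := (sum_sum_norm_sub_sq f).symm
    _ ≤ ∑ i, ∑ j, ρ * ‖x i - x j‖ ^ 2 := by gcongr; exact h _ _
    _ = _ := by
      simp only [← Finset.mul_sum]
      rw [sum_sum_norm_sub_sq]
      ring

section SamplingWithoutReplacement

open Finset
open scoped BigOperators RealInnerProductSpace

variable {ι : Type*} [Fintype ι] [DecidableEq ι] {l : ℕ}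

theorem card_mul_card_filter_mem_powersetCard (hl : 1 ≤ l) (i : ι) :
    Fintype.card ι * #{S ∈ powersetCard l (univ : Finset ι) | i ∈ S} =
      (Fintype.card ι).choose l * l := by
  have h := card_filter_powersetCard_subset {i} (univ : Finset ι) l (subset_univ _) (by simpa)
  simp only [singleton_subset_iff, card_univ, card_singleton] at h
  have hn : 0 < Fintype.card ι := Fintype.card_pos_iff.2 ⟨i⟩
  obtain ⟨m, hm⟩ := Nat.exists_eq_add_of_lt hn
  obtain ⟨k, rfl⟩ := Nat.exists_eq_add_of_le' hl
  rw [h, hm]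
  simpa using Nat.add_one_mul_choose_eq m k

theorem card_mul_card_filter_mem_mem_powersetCard (hl : 1 ≤ l) {i j : ι} (hij : i ≠ j) :
    Fintype.card ι * (Fintype.card ι - 1) *
        #{S ∈ powersetCard l (univ : Finset ι) | i ∈ S ∧ j ∈ S} =
      (Fintype.card ι).choose l * l * (l - 1) := by
  have hpair (S : Finset ι) : i ∈ S ∧ j ∈ S ↔ {i, j} ⊆ S := by
    simp [insert_subset_iff]
  simp only [hpair]
  obtain rfl | hl := hl.eq_or_lt
  · simp only [tsub_self, mul_zero, mul_eq_zero]
    right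
    rw [card_eq_zero, filter_eq_empty_iff]
    intro S hS hs
    have := card_le_card hs
    rw [card_pair hij, (mem_powersetCard.1 hS).2] at this
    omega
  · have h := card_filter_powersetCard_subset {i, j} (univ : Finset ι) l (subset_univ _)
      (by rw [card_pair hij]; exact hl)
    have hn : 2 ≤ Fintype.card ι := by
      rw [← card_pair hij]; exact card_le_univ _
    rw [h, card_univ, card_pair hij]
    obtain ⟨m, hm⟩ := Nat.exists_eq_add_of_le' hn
    obtain ⟨k, rfl⟩ := Nat.exists_eq_add_of_le' hl
    rw [hm]
    have h1 := Nat.add_one_mul_choose_eq m k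
    have h2 := Nat.add_one_mul_choose_eq (m + 1) (k + 1)
    simp only [Nat.add_sub_cancel, Nat.succ_eq_add_one, show m + 2 - 1 = m + 1 from rfl,
      show k + 1 + 1 - 1 = k + 1 from rfl, show k + (1 + 1) - 2 = k by omega] at *
    calc (m + 2) * (m + 1) * m.choose k = (m + 2) * ((m + 1) * m.choose k) := by ring
      _ = (m + 1 + 1) * (m + 1).choose (k + 1) * (k + 1) := by rw [h1]; ring
      _ = _ := by rw [h2]

variable {E : Type*} [NormedAddCommGroup E] [InnerProductSpace ℝ E]

theorem sum_powersetCard_sum_eq_zero (hl : 1 ≤ l) {y : ι → E} (hy : ∑ i, y i = 0) :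
    ∑ S ∈ powersetCard l (univ : Finset ι), ∑ i ∈ S, y i = 0 := by
  have hsum (S : Finset ι) : ∑ i ∈ S, y i = ∑ i, if i ∈ S then y i else 0 := by simp
  simp only [hsum]
  rw [sum_comm]
  obtain hι | hι := isEmpty_or_nonempty ι
  · simp
  have hc : (Fintype.card ι : ℝ) ≠ 0 := by simp
  have hcount (i : ι) : (#{S ∈ powersetCard l (univ : Finset ι) | i ∈ S} : ℝ) =
      (Fintype.card ι).choose l * l / Fintype.card ι := by
    rw [eq_div_iff hc, mul_comm]
    exact_mod_cast card_mul_card_filter_mem_powersetCard hl i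
  simp only [← sum_filter, sum_const, ← Nat.cast_smul_eq_nsmul ℝ, hcount, ← smul_sum, hy, smul_zero]

theorem expect_powersetCard_norm_sum_sq (hn : 2 ≤ Fintype.card ι) (hl : 1 ≤ l)
    (hln : l ≤ Fintype.card ι) {y : ι → E} (hy : ∑ i, y i = 0) :
    𝔼 S ∈ powersetCard l (univ : Finset ι), ‖∑ i ∈ S, y i‖ ^ 2 =
      l * (Fintype.card ι - l) / (Fintype.card ι * (Fintype.card ι - 1)) * ∑ i, ‖y i‖ ^ 2 := by
  have hn' : (2 : ℝ) ≤ Fintype.card ι := by exact_mod_cast hn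
  have hc : (Fintype.card ι : ℝ) ≠ 0 := by positivity
  have hc1 : (Fintype.card ι : ℝ) - 1 ≠ 0 := by linarith
  have hC : ((Fintype.card ι).choose l : ℝ) ≠ 0 := by
    exact_mod_cast (Nat.choose_pos hln).ne'
  set C := ((Fintype.card ι).choose l : ℝ) with hCdef
  set N := (Fintype.card ι : ℝ)
  have hsq (S : Finset ι) : ‖∑ i ∈ S, y i‖ ^ 2 =
      ∑ i, ∑ j, if i ∈ S ∧ j ∈ S then ⟪y i, y j⟫ else 0 := by
    have hsum : ∑ i ∈ S, y i = ∑ i, if i ∈ S then y i else 0 := by simp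
    rw [← real_inner_self_eq_norm_sq, hsum, sum_inner]
    refine sum_congr rfl fun i _ => ?_
    rw [inner_sum]
    refine sum_congr rfl fun j _ => ?_
    by_cases hi : i ∈ S <;> by_cases hj : j ∈ S <;> simp [hi, hj]
  have hcount (i j : ι) : (#{S ∈ powersetCard l (univ : Finset ι) | i ∈ S ∧ j ∈ S} : ℝ) =
      C * l * (l - 1) / (N * (N - 1)) +
        if i = j then C * (l * (N - l) / (N * (N - 1))) else 0 := by
    by_cases hij : i = j
    · subst hij
      have h := congrArg (Nat.cast : ℕ → ℝ) (card_mul_card_filter_mem_powersetCard hl i)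
      push_cast at h
      simp only [and_self, if_true]
      field_simp
      linear_combination (N - 1) * h
    · have h := congrArg (Nat.cast : ℕ → ℝ) (card_mul_card_filter_mem_mem_powersetCard hl hij)
      push_cast [Nat.cast_sub hl, Nat.cast_sub (show 1 ≤ Fintype.card ι by omega)] at h
      rw [if_neg hij, add_zero, eq_div_iff (mul_ne_zero hc hc1), ← h]
      ring
  have hzero : ∑ i, ∑ j, ⟪y i, y j⟫ = 0 := by
    simp [← inner_sum, hy]
  rw [expect_eq_sum_div_card, card_powersetCard, card_univ, ← hCdef, div_eq_iff hC]
  simp only [hsq]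
  rw [sum_comm]
  calc _ = ∑ i, ∑ j,
          (#{S ∈ powersetCard l (univ : Finset ι) | i ∈ S ∧ j ∈ S} : ℝ) * ⟪y i, y j⟫ := by
        refine sum_congr rfl fun i _ => ?_
        rw [sum_comm]
        refine sum_congr rfl fun j _ => ?_
        rw [← sum_filter, sum_const, nsmul_eq_mul]
    _ = _ := by
        simp only [hcount, add_mul, sum_add_distrib, ← mul_sum, hzero, mul_zero, zero_add, ite_mul,
          zero_mul, sum_ite_eq, mem_univ, if_true, real_inner_self_eq_norm_sq]
        ring

end SamplingWithoutReplacement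

section IndependentDraws

open Finset
open scoped BigOperators RealInnerProductSpace

variable {κ : Type*} [Fintype κ] [DecidableEq κ] {α : κ → Type*}
  {T : ∀ k, Finset (α k)}

/-- Resampling one coordinate of a uniform draw from a product does not change expectations. -/
theorem expect_piFinset_update (hT : ∀ k, (T k).Nonempty) (k : κ) (h : (∀ k, α k) → ℝ) :
    𝔼 p ∈ Fintype.piFinset T, 𝔼 t ∈ T k, h (Function.update p k t) =
      𝔼 p ∈ Fintype.piFinset T, h p := by
  have hupd {p : ∀ k, α k} {t : α k} (hp : p ∈ Fintype.piFinset T) (ht : t ∈ T k) :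
      Function.update p k t ∈ Fintype.piFinset T := by
    rw [Fintype.mem_piFinset] at hp ⊢
    intro j
    obtain rfl | hj := eq_or_ne j k
    · simpa
    · simpa [hj] using hp j
  calc _ = 𝔼 q ∈ Fintype.piFinset T ×ˢ T k, h (Function.update q.1 k q.2) :=
        (expect_product' _ _ fun p t => h (Function.update p k t)).symm
    _ = 𝔼 q ∈ Fintype.piFinset T ×ˢ T k, h q.1 := by
        refine expect_nbij' (fun q => (Function.update q.1 k q.2, q.1 k))
          (fun q => (Function.update q.1 k q.2, q.1 k)) ?_ ?_ ?_ ?_ ?_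
        · intro q hq
          rw [mem_product] at hq ⊢
          exact ⟨hupd hq.1 hq.2, Fintype.mem_piFinset.1 hq.1 k⟩
        · intro q hq
          rw [mem_product] at hq ⊢
          exact ⟨hupd hq.1 hq.2, Fintype.mem_piFinset.1 hq.1 k⟩
        all_goals simp
    _ = 𝔼 p ∈ Fintype.piFinset T, 𝔼 _t ∈ T k, h p := expect_product' _ _ fun p _ => h p
    _ = _ := by simp [hT k]

variable {E : Type*} [NormedAddCommGroup E] [InnerProductSpace ℝ E]

/-- The second moment of a sum of independent centred terms, shifted by a constant. -/
theorem expect_piFinset_norm_add_sum_sq (hT : ∀ k, (T k).Nonempty) (a : ∀ k, α k → E)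
    (ha : ∀ k, ∑ t ∈ T k, a k t = 0) (v : E) (A : Finset κ) :
    𝔼 p ∈ Fintype.piFinset T, ‖v + ∑ k ∈ A, a k (p k)‖ ^ 2 =
      ‖v‖ ^ 2 + ∑ k ∈ A, 𝔼 t ∈ T k, ‖a k t‖ ^ 2 := by
  have hne : (Fintype.piFinset T).Nonempty := Fintype.piFinset_nonempty.2 hT
  induction A using Finset.induction_on with
  | empty => simp [hne]
  | insert k A hk ih =>
    have hcross : 𝔼 p ∈ Fintype.piFinset T, ⟪v + ∑ j ∈ A, a j (p j), a k (p k)⟫ = 0 := by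
      rw [← expect_piFinset_update hT k]
      refine expect_eq_zero fun p _ => ?_
      have hA (t : α k) : ∑ j ∈ A, a j (Function.update p k t j) = ∑ j ∈ A, a j (p j) := by
        refine sum_congr rfl fun j hj => ?_
        rw [Function.update_of_ne (ne_of_mem_of_not_mem hj hk)]
      simp only [hA, Function.update_self]
      rw [expect_eq_sum_div_card, ← inner_sum, ha, inner_zero_right, zero_div]
    have hmarg : 𝔼 p ∈ Fintype.piFinset T, ‖a k (p k)‖ ^ 2 = 𝔼 t ∈ T k, ‖a k t‖ ^ 2 := by
      rw [← expect_piFinset_update hT k]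
      simp [hne]
    have hexp (p : ∀ k, α k) : ‖v + ∑ j ∈ insert k A, a j (p j)‖ ^ 2 =
        ‖v + ∑ j ∈ A, a j (p j)‖ ^ 2 + 2 * ⟪v + ∑ j ∈ A, a j (p j), a k (p k)⟫ +
          ‖a k (p k)‖ ^ 2 := by
      rw [← norm_add_sq_real, sum_insert hk, add_comm (a k _), add_assoc]
    simp only [hexp, expect_add_distrib, ← mul_expect]
    rw [ih, hcross, hmarg, sum_insert hk]
    ring

end IndependentDraws

section MiniBatch

open Finset
open scoped BigOperators

/-- The error of a mini-batch mean is the mini-batch mean of the centred family. -/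
theorem inv_smul_sum_sub_of_mem_powersetCard {ι E : Type*} [Fintype ι] [AddCommGroup E]
    [Module ℝ E] {l : ℕ} (hl : 1 ≤ l) (g : ι → E) (m : E) {S : Finset ι}
    (hS : S ∈ powersetCard l (univ : Finset ι)) :
    (l : ℝ)⁻¹ • ∑ i ∈ S, g i - m = (l : ℝ)⁻¹ • ∑ i ∈ S, (g i - m) := by
  have hl0 : (l : ℝ) ≠ 0 := by exact_mod_cast (by omega : l ≠ 0)
  rw [sum_sub_distrib, sum_const, (mem_powersetCard.1 hS).2, smul_sub, ← Nat.cast_smul_eq_nsmul ℝ,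
    inv_smul_smul₀ hl0]

variable {ι E : Type*} [Fintype ι] [DecidableEq ι] [NormedAddCommGroup E] [InnerProductSpace ℝ E]
  {l : ℕ}

theorem sum_powersetCard_miniBatch_error_eq_zero [Nonempty ι] (hl : 1 ≤ l) (g : ι → E) :
    ∑ S ∈ powersetCard l (univ : Finset ι),
      ((l : ℝ)⁻¹ • ∑ i ∈ S, g i - (Fintype.card ι : ℝ)⁻¹ • ∑ i, g i) = 0 := by
  rw [sum_congr rfl fun S hS => inv_smul_sum_sub_of_mem_powersetCard hl g _ hS, ← smul_sum,
    sum_powersetCard_sum_eq_zero hl (sum_sub_mean_eq_zero g), smul_zero]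

/-- The variance of the mean of a uniform sample drawn without replacement. -/
theorem expect_powersetCard_miniBatch_error_sq (hn : 2 ≤ Fintype.card ι) (hl : 1 ≤ l)
    (hln : l ≤ Fintype.card ι) (g : ι → E) :
    𝔼 S ∈ powersetCard l (univ : Finset ι),
        ‖(l : ℝ)⁻¹ • ∑ i ∈ S, g i - (Fintype.card ι : ℝ)⁻¹ • ∑ i, g i‖ ^ 2 =
      (1 - l / Fintype.card ι) / l *
        ((∑ i, ‖g i - (Fintype.card ι : ℝ)⁻¹ • ∑ j, g j‖ ^ 2) / (Fintype.card ι - 1)) := by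
  have : Nonempty ι := Fintype.card_pos_iff.1 (by omega)
  have hn' : (2 : ℝ) ≤ Fintype.card ι := by exact_mod_cast hn
  have hc1 : (Fintype.card ι : ℝ) - 1 ≠ 0 := by linarith
  have hl0 : (l : ℝ) ≠ 0 := by exact_mod_cast (by omega : l ≠ 0)
  rw [expect_congr rfl fun S hS => by
    rw [inv_smul_sum_sub_of_mem_powersetCard hl g _ hS, norm_smul, mul_pow], ← mul_expect,
    expect_powersetCard_norm_sum_sq hn hl hln (sum_sub_mean_eq_zero g), norm_inv,
    RCLike.norm_natCast]
  field_simp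

/-- The variance of the size-weighted mini-batch error, bounded by the data variance. -/
theorem sq_mul_expect_miniBatch_error_sq_le {F : Type*} [NormedAddCommGroup F]
    [InnerProductSpace ℝ F] {n : ℕ} (hn : 2 ≤ n) (hl : 1 ≤ l) (hln : l ≤ n) {ρ s : ℝ} (hs : n ≤ s)
    {g : Fin n → E} {x : Fin n → F}
    (h : ∀ i j, ‖g i - g j‖ ^ 2 ≤ ρ * ‖x i - x j‖ ^ 2) :
    (s⁻¹ * n) ^ 2 * 𝔼 S ∈ powersetCard l (univ : Finset (Fin n)),
        ‖(l : ℝ)⁻¹ • ∑ i ∈ S, g i - (n : ℝ)⁻¹ • ∑ i, g i‖ ^ 2 ≤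
      2 / s * ((1 - l / n) * ((n - 1) * ρ / l) *
        ((∑ i, ‖x i - (n : ℝ)⁻¹ • ∑ j, x j‖ ^ 2) / (n - 1))) := by
  have : Nonempty (Fin n) := ⟨⟨0, by omega⟩⟩
  have hn' : (2 : ℝ) ≤ n := by exact_mod_cast hn
  have hs0 : 0 < s := by linarith
  have hl0 : (0 : ℝ) < l := by exact_mod_cast hl
  have hln' : (l : ℝ) ≤ n := by exact_mod_cast hln
  have hfrac : 0 ≤ 1 - (l : ℝ) / n := sub_nonneg.2 (div_le_one_of_le₀ hln' (by positivity))
  have hn1 : (0 : ℝ) < n - 1 := by linarith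
  have hE := expect_powersetCard_miniBatch_error_sq (ι := Fin n) (by simpa) hl (by simpa) g
  have hV := sum_norm_sub_mean_sq_le h
  simp only [Fintype.card_fin] at hE hV
  have hcoef : (s⁻¹ * n) ^ 2 ≤ 2 / s * (n - 1) := by
    have h1 : (s⁻¹ * n) ^ 2 = 1 / s * (n * (n / s)) := by field_simp
    have h2 : 2 / s * ((n : ℝ) - 1) = 1 / s * (2 * (n - 1)) := by ring
    have h3 : (n : ℝ) / s ≤ 1 := div_le_one_of_le₀ hs hs0.le
    rw [h1, h2]
    exact mul_le_mul_of_nonneg_left (by nlinarith) (by positivity)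
  rw [hE]
  calc _ ≤ 2 / s * (n - 1) * ((1 - l / n) / l *
        ((ρ * ∑ i, ‖x i - (n : ℝ)⁻¹ • ∑ j, x j‖ ^ 2) / (n - 1))) := by gcongr
    _ = _ := by ring

end MiniBatch

/-- Per-cluster stochastic gradient error bound (equations (47)–(50) in the proof of
Theorem 1): the expected squared norm of the aggregated mini-batch gradient error,
averaged over independent uniform without-replacement draws at the satellite and at each
client, is bounded by `(2/s)[Σ_k (1−λ_k/n_k)((n_k−1)ρ/λ_k)V_k + (1−λ_S/n_S)((n_S−1)ρ/λ_S)V_S]`. -/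
theorem per_cluster_gradient_error_bound
    {X H : Type*} [NormedAddCommGroup X] [InnerProductSpace ℝ X]
    [NormedAddCommGroup H] [InnerProductSpace ℝ H]
    {G : Type*} [Fintype G] [DecidableEq G]
    (n : G → ℕ) (hn : ∀ k, 2 ≤ n k)
    (lam : G → ℕ) (hlam : ∀ k, 1 ≤ lam k ∧ lam k ≤ n k)
    (nS lamS : ℕ) (hnS : 2 ≤ nS) (hlamS : 1 ≤ lamS ∧ lamS ≤ nS)
    (s : ℝ) (hs : s = (nS : ℝ) + ∑ k, (n k : ℝ))
    (ρ : ℝ) (hρ : 0 ≤ ρ)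
    (x : (k : G) → Fin (n k) → X) (g : (k : G) → Fin (n k) → H)
    (hlip : ∀ k i i', ‖g k i - g k i'‖ ^ 2 ≤ ρ * ‖x k i - x k i'‖ ^ 2)
    (xS : Fin nS → X) (gS : Fin nS → H)
    (hlipS : ∀ i i', ‖gS i - gS i'‖ ^ 2 ≤ ρ * ‖xS i - xS i'‖ ^ 2)
    (V : G → ℝ)
    (hV : ∀ k, V k = (∑ i, ‖x k i - (n k : ℝ)⁻¹ • ∑ i', x k i'‖ ^ 2) / ((n k : ℝ) - 1))
    (VS : ℝ)
    (hVS : VS = (∑ i, ‖xS i - (nS : ℝ)⁻¹ • ∑ i', xS i'‖ ^ 2) / ((nS : ℝ) - 1))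
    (gbar : (k : G) → H) (hgbar : ∀ k, gbar k = (n k : ℝ)⁻¹ • ∑ i, g k i)
    (gSbar : H) (hgSbar : gSbar = (nS : ℝ)⁻¹ • ∑ i, gS i) :
    ∑ SS ∈ Finset.powersetCard lamS (Finset.univ : Finset (Fin nS)),
      ∑ Sc ∈ Fintype.piFinset
          (fun k => Finset.powersetCard (lam k) (Finset.univ : Finset (Fin (n k)))),
        ((nS.choose lamS : ℝ)⁻¹ * ∏ k, ((n k).choose (lam k) : ℝ)⁻¹) *
          ‖s⁻¹ • ((nS : ℝ) • ((lamS : ℝ)⁻¹ • ∑ i ∈ SS, gS i - gSbar) +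
              ∑ k, (n k : ℝ) • ((lam k : ℝ)⁻¹ • ∑ i ∈ Sc k, g k i - gbar k))‖ ^ 2 ≤
      (2 / s) * ((∑ k, (1 - (lam k : ℝ) / (n k : ℝ)) *
            (((n k : ℝ) - 1) * ρ / (lam k : ℝ)) * V k) +
          (1 - (lamS : ℝ) / (nS : ℝ)) * (((nS : ℝ) - 1) * ρ / (lamS : ℝ)) * VS) := by
  have hs_nonneg : ∀ k, (0 : ℝ) ≤ n k := fun k => Nat.cast_nonneg _
  have hSs : (nS : ℝ) ≤ s := hs ▸ le_add_of_nonneg_right (Finset.sum_nonneg fun k _ => hs_nonneg k)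
  have hks (k : G) : (n k : ℝ) ≤ s := by
    rw [hs]
    exact (Finset.single_le_sum (fun k _ => hs_nonneg k) (Finset.mem_univ k)).trans
      (le_add_of_nonneg_left (Nat.cast_nonneg _))
  have hSnonempty : Nonempty (Fin nS) := ⟨⟨0, by omega⟩⟩
  have hnonempty (k : G) : Nonempty (Fin (n k)) := ⟨⟨0, by have := hn k; omega⟩⟩
  set T : ∀ k, Finset (Finset (Fin (n k))) := fun k => Finset.powersetCard (lam k) Finset.univ
  set TS : Finset (Finset (Fin nS)) := Finset.powersetCard lamS Finset.univ
  have hT (k : G) : (T k).Nonempty := Finset.powersetCard_nonempty.2 (by simpa using (hlam k).2)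
  have hTS : TS.Nonempty := Finset.powersetCard_nonempty.2 (by simpa using hlamS.2)
  set a : ∀ k, Finset (Fin (n k)) → H := fun k S =>
    (s⁻¹ * n k) • ((lam k : ℝ)⁻¹ • ∑ i ∈ S, g k i - gbar k) with ha
  set aS : Finset (Fin nS) → H := fun S => (s⁻¹ * nS) • ((lamS : ℝ)⁻¹ • ∑ i ∈ S, gS i - gSbar)
    with haS
  have ha0 (k : G) : ∑ S ∈ T k, a k S = 0 := by
    have := sum_powersetCard_miniBatch_error_eq_zero (hlam k).1 (g k)
    rw [Fintype.card_fin] at this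
    rw [ha, ← Finset.smul_sum, hgbar, this, smul_zero]
  have hexpect : ∑ SS ∈ TS, ∑ Sc ∈ Fintype.piFinset T,
        ((nS.choose lamS : ℝ)⁻¹ * ∏ k, ((n k).choose (lam k) : ℝ)⁻¹) *
          ‖s⁻¹ • ((nS : ℝ) • ((lamS : ℝ)⁻¹ • ∑ i ∈ SS, gS i - gSbar) +
              ∑ k, (n k : ℝ) • ((lam k : ℝ)⁻¹ • ∑ i ∈ Sc k, g k i - gbar k))‖ ^ 2 =
      Finset.expect TS fun SS => Finset.expect (Fintype.piFinset T) fun Sc =>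
        ‖aS SS + ∑ k, a k (Sc k)‖ ^ 2 := by
    simp only [Finset.expect_eq_sum_div_card, Fintype.card_piFinset, T, TS,
      Finset.card_powersetCard, Finset.card_univ, Fintype.card_fin, Finset.sum_div, ha, haS,
      smul_add, Finset.smul_sum (r := s⁻¹), smul_smul (s⁻¹), Nat.cast_prod, Finset.prod_inv_distrib]
    refine Finset.sum_congr rfl fun SS _ => Finset.sum_congr rfl fun Sc _ => ?_
    ring
  rw [hexpect]
  simp only [expect_piFinset_norm_add_sum_sq hT a ha0, Finset.expect_add_distrib,
    Finset.expect_const hTS]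
  rw [mul_add, add_comm, Finset.mul_sum]
  refine add_le_add (Finset.sum_le_sum fun k _ => ?_) ?_
  · simp only [ha, norm_smul, mul_pow, ← Finset.mul_expect, Real.norm_eq_abs, sq_abs]
    rw [hgbar, hV]
    simpa only [mul_pow] using
      sq_mul_expect_miniBatch_error_sq_le (hn k) (hlam k).1 (hlam k).2 (hks k) (hlip k)
  · simp only [haS, norm_smul, mul_pow, ← Finset.mul_expect, Real.norm_eq_abs, sq_abs]
    rw [hgSbar, hVS]
    simpa only [mul_pow] using
      sq_mul_expect_miniBatch_error_sq_le hnS hlamS.1 hlamS.2 hSs hlipS
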